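/- The only solution in integers x ≥ 2, y ≥ 2 of x^3 - y^2 = -1 is (x, y) = (2, 3), and x^3 - y^2 = 1 has no solution with x ≥ 2, y ≥ 2. -/

import Mathlib

/-- The Eisenstein integers `ℤ[ω]`, with `ω ^ 2 = -1 - ω`. -/
abbrev Eis := QuadraticAlgebra ℤ (-1) (-1)

namespace Eis

/-- The norm form. -/
def nn (z : Eis) : ℤ := z.re ^ 2 - z.re * z.im + z.im ^ 2

theorem nn_mul (z w : Eis) : nn (z * w) = nn z * nn w := by
  simp only [nn, QuadraticAlgebra.re_mul, QuadraticAlgebra.im_mul]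
  ring

theorem nn_nonneg (z : Eis) : 0 ≤ nn z := by
  unfold nn
  nlinarith [sq_nonneg (z.re - z.im), sq_nonneg (z.re + z.im)]

theorem nn_pos {z : Eis} (hz : z ≠ 0) : 0 < nn z := by
  by_contra h
  apply hz
  unfold nn at h
  have h1 : z.re ^ 2 ≤ 0 := by
    nlinarith [sq_nonneg (z.re - z.im), sq_nonneg (z.re + z.im), sq_nonneg z.im]
  have h2 : z.im ^ 2 ≤ 0 := by
    nlinarith [sq_nonneg (z.re - z.im), sq_nonneg (z.re + z.im), sq_nonneg z.re]
  have h3 : z.re = 0 := by nlinarith [pow_eq_zero_iff (two_ne_zero) |>.1 (le_antisymm h1 (sq_nonneg _))]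
  have h4 : z.im = 0 := by nlinarith [pow_eq_zero_iff (two_ne_zero) |>.1 (le_antisymm h2 (sq_nonneg _))]
  ext <;> simp [h3, h4]

theorem int_round (c n : ℤ) (hn : 0 < n) : ∃ q r : ℤ, c = n * q + r ∧ -n ≤ 2 * r ∧ 2 * r ≤ n := by
  have h1 := Int.emod_add_mul_ediv c n
  have h2 := Int.emod_nonneg c hn.ne'
  have h3 := Int.emod_lt_of_pos c hn
  by_cases h : 2 * (c % n) ≤ n
  · exact ⟨c / n, c % n, by linarith, by linarith, h⟩
  · exact ⟨c / n + 1, c % n - n, by linarith, by linarith, by linarith⟩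

theorem exists_quot (x y : Eis) (hy : y ≠ 0) : ∃ q : Eis, nn (x - y * q) < nn y := by
  have hn := nn_pos hy
  let yb : Eis := ⟨y.re - y.im, -y.im⟩
  have hyb : nn yb = nn y := by simp only [nn, yb]; ring
  obtain ⟨q1, r1, h1, h1a, h1b⟩ := int_round (x * yb).re (nn y) hn
  obtain ⟨q2, r2, h2, h2a, h2b⟩ := int_round (x * yb).im (nn y) hn
  refine ⟨⟨q1, q2⟩, ?_⟩
  have key : (x - y * ⟨q1, q2⟩) * yb = ⟨r1, r2⟩ := by
    ext
    · have : r1 = (x * yb).re - nn y * q1 := by linarith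
      simp only [this, nn, yb, QuadraticAlgebra.re_mul, QuadraticAlgebra.im_mul,
        QuadraticAlgebra.re_sub, QuadraticAlgebra.im_sub]
      ring
    · have : r2 = (x * yb).im - nn y * q2 := by linarith
      simp only [this, nn, yb, QuadraticAlgebra.re_mul, QuadraticAlgebra.im_mul,
        QuadraticAlgebra.re_sub, QuadraticAlgebra.im_sub]
      ring
  have h3 : nn (x - y * ⟨q1, q2⟩) * nn y = r1 ^ 2 - r1 * r2 + r2 ^ 2 := by
    rw [← hyb, ← nn_mul, key]; rfl
  have h4 : 4 * (r1 ^ 2 - r1 * r2 + r2 ^ 2) ≤ 3 * nn y ^ 2 := by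
    have a1 : (2 * r1) ^ 2 ≤ nn y ^ 2 := sq_le_sq' h1a h1b
    have a2 : (2 * r2) ^ 2 ≤ nn y ^ 2 := sq_le_sq' h2a h2b
    have a3 : 0 ≤ (nn y - 2 * r1) * (nn y + 2 * r2) := mul_nonneg (by linarith) (by linarith)
    have a4 : 0 ≤ (nn y + 2 * r1) * (nn y - 2 * r2) := mul_nonneg (by linarith) (by linarith)
    nlinarith
  by_contra h
  push Not at h
  nlinarith

open Classical in
/-- Euclidean quotient. -/
noncomputable def quot (x y : Eis) : Eis :=
  if hy : y = 0 then 0 else (exists_quot x y hy).choose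

theorem quot_spec (x y : Eis) (hy : y ≠ 0) : nn (x - y * quot x y) < nn y := by
  unfold quot
  rw [dif_neg hy]
  exact (exists_quot x y hy).choose_spec

noncomputable instance : EuclideanDomain Eis where
  quotient := quot
  quotient_zero a := by simp [quot]
  remainder x y := x - y * quot x y
  quotient_mul_add_remainder_eq a b := by ring
  r x y := (nn x).toNat < (nn y).toNat
  r_wellFounded := (measure fun z : Eis => (nn z).toNat).wf
  remainder_lt a b hb := by
    have h1 := quot_spec a b hb
    have h2 := nn_nonneg (a - b * quot a b)
    omega
  mul_left_not_lt a b hb := by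
    have h1 := nn_pos hb
    have h2 := nn_nonneg a
    have h3 : nn a ≤ nn (a * b) := by rw [nn_mul]; nlinarith
    omega

theorem unit_norm (u : Eisˣ) : nn (u : Eis) = 1 := by
  have h : nn (u : Eis) * nn (↑u⁻¹ : Eis) = 1 := by
    rw [← nn_mul, Units.mul_inv]; simp [nn, QuadraticAlgebra.re_one, QuadraticAlgebra.im_one]
  have h1 := nn_nonneg (u : Eis)
  exact Int.eq_one_of_mul_eq_one_right h1 h

end Eis

theorem cube_even (g : Eis) : ∃ c v : ℤ, g ^ 3 = (⟨c, 2 * v⟩ : Eis) ^ 3 := by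
  obtain ⟨c, d⟩ := g
  rcases Int.even_or_odd' d with ⟨k, hk | hk⟩
  · exact ⟨c, k, by rw [hk]⟩
  · rcases Int.even_or_odd' c with ⟨l, hl | hl⟩
    · refine ⟨d - c, -l, ?_⟩
      ext <;> simp only [pow_succ, pow_zero, one_mul, QuadraticAlgebra.re_mul,
        QuadraticAlgebra.im_mul] <;> subst hl <;> ring
    · refine ⟨-d, l - k, ?_⟩
      ext <;> simp only [pow_succ, pow_zero, one_mul, QuadraticAlgebra.re_mul,
        QuadraticAlgebra.im_mul] <;> subst hl <;> subst hk <;> ring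

theorem cube_form {p q w : ℤ} (hpq : IsCoprime p q) (hodd : Odd (p + q)) (h3 : ¬ (3 : ℤ) ∣ p)
    (h : p ^ 2 + 3 * q ^ 2 = w ^ 3) :
    ∃ u v : ℤ, p = u * ((u - 3 * v) * (u + 3 * v)) ∧ q = 3 * (v * ((u - v) * (u + v))) := by
  have hN2 : IsCoprime (p ^ 2 + 3 * q ^ 2) 2 := by
    obtain ⟨k, hk⟩ := hodd
    have : q = 2 * k + 1 - p := by linarith
    subst this
    exact ⟨1, -(2 * p ^ 2 - 3 * p * (2 * k + 1) + 6 * k ^ 2 + 6 * k + 1), by ring⟩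
  have hp3 : IsCoprime p 3 := ((Int.prime_three.coprime_iff_not_dvd).2 h3).symm
  have hNp : IsCoprime (p ^ 2 + 3 * q ^ 2) p := by
    have h1 : IsCoprime (3 * q ^ 2) p := (hp3.mul_right hpq.pow_right).symm
    have := h1.add_mul_left_left p
    rwa [show 3 * q ^ 2 + p * p = p ^ 2 + 3 * q ^ 2 by ring] at this
  obtain ⟨s, t, hst⟩ := hN2.mul_right hNp
  have hco : IsCoprime (⟨p + q, 2 * q⟩ : Eis) ⟨p - q, -2 * q⟩ := by
    refine ⟨⟨s * (p - q) + t, s * (-2 * q)⟩, ⟨t, 0⟩, ?_⟩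
    ext
    · simp [QuadraticAlgebra.re_one]
      linear_combination hst
    · simp [QuadraticAlgebra.im_one]
      ring
  have hmul : (⟨p + q, 2 * q⟩ : Eis) * ⟨p - q, -2 * q⟩ = (⟨w, 0⟩ : Eis) ^ 3 := by
    ext <;> simp only [pow_succ, pow_zero, one_mul, QuadraticAlgebra.re_mul,
        QuadraticAlgebra.im_mul]
    · linear_combination h
    · ring
  obtain ⟨g, e, hg⟩ := exists_associated_pow_of_mul_eq_pow' hco hmul
  obtain ⟨c, v, hcv⟩ := cube_even g
  have he := Eis.unit_norm e
  rw [hcv] at hg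
  obtain ⟨u, rfl⟩ : ∃ u, c = u + v := ⟨c - v, by ring⟩
  generalize (e : Eis) = e' at hg he
  obtain ⟨e0, f0⟩ := e'
  simp only [Eis.nn] at he
  have hre := congrArg QuadraticAlgebra.re hg
  have him := congrArg QuadraticAlgebra.im hg
  simp only [pow_succ, pow_zero, one_mul, QuadraticAlgebra.re_mul,
        QuadraticAlgebra.im_mul] at hre him
  obtain ⟨U, hU⟩ : ∃ U, U = u * ((u - 3 * v) * (u + 3 * v)) := ⟨_, rfl⟩
  obtain ⟨V, hV⟩ : ∃ V, V = 3 * (v * ((u - v) * (u + v))) := ⟨_, rfl⟩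
  have hre' : (U + V) * e0 - 2 * V * f0 = p + q := by
    rw [← hre, hU, hV]; ring
  have him' : 2 * V * e0 + f0 * (U + V) - 2 * V * f0 = 2 * q := by
    rw [← him, hU, hV]; ring
  have hUV : Odd (U + V) := by
    have : Odd ((U + V) * e0) := by
      rw [show (U + V) * e0 = (p + q) + 2 * (V * f0) by linarith]
      exact hodd.add_even (even_two_mul _)
    exact (Int.odd_mul.1 this).1
  have hf : Even f0 := by
    have : Even (f0 * (U + V)) := ⟨q - V * e0 + V * f0, by linarith⟩
    rcases Int.even_mul.1 this with h | h
    · exact h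
    · exact absurd h (Int.not_even_iff_odd.2 hUV)
  have hf0 : f0 = 0 := by
    obtain ⟨m, rfl⟩ := hf
    have : m ^ 2 < 1 := by nlinarith [sq_nonneg (2 * e0 - (m + m))]
    have : m = 0 := by nlinarith [pow_eq_zero_iff (two_ne_zero) |>.1 (le_antisymm (Int.lt_add_one_iff.1 (by simpa using this)) (sq_nonneg m))]
    simp [this]
  subst hf0
  have he1 : e0 = 1 ∨ e0 = -1 := by
    exact sq_eq_one_iff.1 (by linarith)
  rcases he1 with rfl | rfl
  · exact ⟨u, v, by linarith, by linarith⟩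
  · refine ⟨-u, -v, ?_, ?_⟩
    · have : p = -U := by linarith
      rw [this, hU]; ring
    · have : q = -V := by linarith
      rw [this, hV]; ring

theorem cubes {a b c : ℤ} (hab : IsCoprime a b) (h : a * b = c ^ 3) :
    (∃ d, a = d ^ 3) ∧ ∃ d, b = d ^ 3 :=
  ⟨Int.eq_pow_of_mul_eq_pow_odd_left hab (by decide) h,
   Int.eq_pow_of_mul_eq_pow_odd_right hab (by decide) h⟩

theorem natAbs_lt_of_cube {c z : ℤ} (h : |c ^ 3| < |z ^ 3|) : c.natAbs < z.natAbs := by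
  rw [abs_pow, abs_pow] at h
  exact Int.natAbs_lt_iff_sq_lt.2 (sq_lt_sq.2 (lt_of_pow_lt_pow_left₀ 3 (abs_nonneg z) h))

theorem descent (n : ℕ) : ∀ x y z : ℤ, z.natAbs = n → IsCoprime x y →
    x ^ 3 + y ^ 3 = 2 * z ^ 3 → z ≠ 0 → x ≠ y → False := by
  induction n using Nat.strong_induction_on with
  | _ n ih =>
  intro x y z hn hxy h hz hne
  subst hn
  have hsum : Even (x + y) := by
    have h1 : Even (x ^ 3 + y ^ 3) := by rw [h]; exact even_two_mul _
    simpa [Int.even_add, Int.even_pow] using h1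
  obtain ⟨p, hp⟩ := hsum
  obtain ⟨q, hq⟩ : ∃ q, q = x - p := ⟨_, rfl⟩
  obtain rfl : x = p + q := by linarith
  obtain rfl : y = p - q := by linarith
  have hpq : IsCoprime p q := by
    obtain ⟨a, b, hab⟩ := hxy
    exact ⟨a + b, a - b, by linear_combination hab⟩
  have hodd : Odd (p + q) := by
    rw [← Int.not_even_iff_odd]
    intro he
    have h1 : (2 : ℤ) ∣ p + q := he.two_dvd
    have h2 : (2 : ℤ) ∣ p - q := by omega
    have := hxy.isUnit_of_dvd' h1 h2
    exact absurd this (by decide)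
  have hq0 : q ≠ 0 := by rintro rfl; apply hne; ring
  have hz3 : p * (p ^ 2 + 3 * q ^ 2) = z ^ 3 := by linarith
  have hp0 : p ≠ 0 := by
    rintro rfl
    apply hz
    have : z ^ 3 = 0 := by rw [← hz3]; ring
    exact pow_eq_zero_iff (by norm_num) |>.1 this
  have hq1 : 1 ≤ q ^ 2 := by have := sq_pos_of_ne_zero hq0; linarith
  have hp1 : 1 ≤ p ^ 2 := by have := sq_pos_of_ne_zero hp0; linarith
  have hlt : |p| < |z ^ 3| := by
    rw [← hz3, abs_mul]
    have h1 : 0 < |p| := abs_pos.2 hp0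
    have h2 : 4 ≤ |p ^ 2 + 3 * q ^ 2| := le_trans (by linarith) (le_abs_self _)
    nlinarith
  by_cases h3 : (3 : ℤ) ∣ p
  · obtain ⟨s, rfl⟩ := h3
    have hq3 : ¬ (3 : ℤ) ∣ q := by
      intro hd
      have := hpq.isUnit_of_dvd' (Dvd.intro _ rfl) hd
      exact absurd this (by decide)
    have hzd : (3 : ℤ) ∣ z := by
      apply Int.prime_three.dvd_of_dvd_pow (n := 3)
      exact ⟨s * ((3 * s) ^ 2 + 3 * q ^ 2), by rw [← hz3]; ring⟩
    obtain ⟨w, rfl⟩ := hzd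
    have hw : s * (q ^ 2 + 3 * s ^ 2) = 3 * w ^ 3 := by linarith
    have hsd : (3 : ℤ) ∣ s := by
      have h1 : (3 : ℤ) ∣ s * (q ^ 2 + 3 * s ^ 2) := ⟨_, hw⟩
      rcases Int.prime_three.dvd_or_dvd h1 with h2 | h2
      · exact h2
      · exfalso
        apply hq3
        apply Int.prime_three.dvd_of_dvd_pow (n := 2)
        exact (Int.dvd_add_left ⟨s ^ 2, rfl⟩).1 h2
    obtain ⟨t, rfl⟩ := hsd
    have hw' : t * (q ^ 2 + 3 * (3 * t) ^ 2) = w ^ 3 := by linarith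
    have htq : IsCoprime t q := hpq.of_isCoprime_of_dvd_left ⟨9, by ring⟩
    have hco : IsCoprime t (q ^ 2 + 3 * (3 * t) ^ 2) := by
      have := (htq.pow_right (n := 2)).add_mul_left_right (27 * t)
      rwa [show q ^ 2 + t * (27 * t) = q ^ 2 + 3 * (3 * t) ^ 2 by ring] at this
    obtain ⟨⟨r, hr⟩, ⟨m, hm⟩⟩ := cubes hco hw'
    have hq3t : IsCoprime q (3 * t) := (hpq.of_isCoprime_of_dvd_left ⟨3, by ring⟩).symm
    have hodd' : Odd (q + 3 * t) := by
      obtain ⟨k, hk⟩ := hodd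
      exact ⟨k - 3 * t, by linarith⟩
    obtain ⟨u, v, hu, hv⟩ := cube_form hq3t hodd' hq3 hm
    have htv : t = v * ((u - v) * (u + v)) := by linarith
    have c1 : IsCoprime v u :=
      (htq.of_isCoprime_of_dvd_left ⟨_, htv⟩).of_isCoprime_of_dvd_right ⟨_, hu⟩
    have c2 : IsCoprime v (u - v) := by
      have := c1.add_mul_left_right (-1)
      rwa [show u + v * (-1) = u - v by ring] at this
    have c3 : IsCoprime v (u + v) := by
      have := c1.add_mul_left_right 1
      rwa [show u + v * 1 = u + v by ring] at this
    have huv : Odd (u - v) := by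
      rw [hu, hv] at hodd'
      simp only [← Int.not_even_iff_odd, Int.even_add, Int.even_mul, Int.even_sub] at hodd' ⊢
      have e3 : ¬ Even (3 : ℤ) := by decide
      tauto
    have c4 : IsCoprime (u - v) (u + v) := by
      have h2 : IsCoprime (u - v) 2 := by
        obtain ⟨k, hk⟩ := huv
        exact ⟨1, -k, by rw [hk]; ring⟩
      have := (h2.mul_right c2.symm).add_mul_left_right 1
      rwa [show 2 * v + (u - v) * 1 = u + v by ring] at this
    obtain ⟨⟨c, hc⟩, ⟨d, hd⟩⟩ := cubes (c2.mul_right c3) (htv.symm.trans hr)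
    obtain ⟨⟨a, ha⟩, ⟨b, hb⟩⟩ := cubes c4 hd
    have cab : IsCoprime b (-a) := by
      rw [ha, hb] at c4
      exact ((IsCoprime.pow_iff (by norm_num) (by norm_num)).1 c4).symm.neg_right
    have hv0 : v ≠ 0 := by rintro rfl; apply hp0; rw [htv]; ring
    have hu0 : u ≠ 0 := by rintro rfl; apply hq0; rw [hu]; ring
    refine ih c.natAbs ?_ b (-a) c rfl cab ?_ ?_ ?_
    · apply natAbs_lt_of_cube
      refine lt_of_le_of_lt ?_ hlt
      rw [← hc]
      refine Int.le_of_dvd (abs_pos.2 hp0) ((abs_dvd_abs _ _).2 ?_)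
      exact ⟨9 * ((u - v) * (u + v)), by rw [htv]; ring⟩
    · linear_combination -hb + ha + 2 * hc
    · rintro rfl; apply hv0; rw [hc]; norm_num
    · rintro rfl; apply hu0; have h7 : (-a) ^ 3 = -a ^ 3 := by ring
      linarith
  · have hp3 : IsCoprime p 3 := ((Int.prime_three.coprime_iff_not_dvd).2 h3).symm
    have hco : IsCoprime p (p ^ 2 + 3 * q ^ 2) := by
      have := (hp3.mul_right (hpq.pow_right (n := 2))).add_mul_left_right p
      rwa [show 3 * q ^ 2 + p * p = p ^ 2 + 3 * q ^ 2 by ring] at this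
    obtain ⟨⟨r, hr⟩, ⟨m, hm⟩⟩ := cubes hco hz3
    obtain ⟨u, v, hu, hv⟩ := cube_form hpq hodd h3 hm
    have c1 : IsCoprime u (3 * v) :=
      (hpq.of_isCoprime_of_dvd_left ⟨_, hu⟩).of_isCoprime_of_dvd_right
        ⟨(u - v) * (u + v), by rw [hv]; ring⟩
    have c2 : IsCoprime u (u - 3 * v) := by
      have := c1.neg_right.add_mul_left_right 1
      rwa [show -(3 * v) + u * 1 = u - 3 * v by ring] at this
    have c3 : IsCoprime u (u + 3 * v) := by
      have := c1.add_mul_left_right 1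
      rwa [show 3 * v + u * 1 = u + 3 * v by ring] at this
    have huv : Odd (u - 3 * v) := by
      rw [hu, hv] at hodd
      have e3 : ¬ Even (3 : ℤ) := by decide
      simp only [← Int.not_even_iff_odd, Int.even_add, Int.even_mul, Int.even_sub] at hodd ⊢
      tauto
    have c4 : IsCoprime (u - 3 * v) (u + 3 * v) := by
      have h2 : IsCoprime (u - 3 * v) 2 := by
        obtain ⟨k, hk⟩ := huv
        exact ⟨1, -k, by rw [hk]; ring⟩
      have h5 : IsCoprime (u - 3 * v) (3 * v) := by
        have := c1.add_mul_left_left (-1)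
        rwa [show u + 3 * v * (-1) = u - 3 * v by ring] at this
      have := (h2.mul_right h5).add_mul_left_right 1
      rwa [show 2 * (3 * v) + (u - 3 * v) * 1 = u + 3 * v by ring] at this
    obtain ⟨⟨c, hc⟩, ⟨d, hd⟩⟩ := cubes (c2.mul_right c3) (hu.symm.trans hr)
    obtain ⟨⟨a, ha⟩, ⟨b, hb⟩⟩ := cubes c4 hd
    have cab : IsCoprime a b := by
      rw [ha, hb] at c4
      exact (IsCoprime.pow_iff (by norm_num) (by norm_num)).1 c4
    have hv0 : v ≠ 0 := by rintro rfl; apply hq0; rw [hv]; ring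
    have hu0 : u ≠ 0 := by rintro rfl; apply hp0; rw [hu]; ring
    refine ih c.natAbs ?_ a b c rfl cab ?_ ?_ ?_
    · apply natAbs_lt_of_cube
      refine lt_of_le_of_lt ?_ hlt
      rw [← hc]
      exact Int.le_of_dvd (abs_pos.2 hp0) ((abs_dvd_abs _ _).2 ⟨_, hu⟩)
    · linear_combination -hb - ha + 2 * hc
    · rintro rfl; apply hu0; rw [hc]; norm_num
    · rintro rfl; apply hv0; linarith

theorem part_one (x y : ℤ) (hy : 2 ≤ y) (h : x ^ 3 - y ^ 2 = -1) :
    x = 2 ∧ y = 3 := by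
  have hprod : (y - 1) * (y + 1) = x ^ 3 := by linarith
  rcases Int.even_or_odd' y with ⟨k, hk | hk⟩
  · exfalso
    have hco : IsCoprime (y - 1) (y + 1) := ⟨-(k + 1), k, by rw [hk]; ring⟩
    obtain ⟨⟨a, ha⟩, ⟨b, hb⟩⟩ := cubes hco hprod
    have ha0 : 0 < a := by
      by_contra hh
      have : a ^ 3 ≤ 0 := Odd.pow_nonpos (by decide) (by linarith)
      linarith
    have hab : a < b := by
      by_contra hh
      have : b ^ 3 ≤ a ^ 3 := (Odd.strictMono_pow (by decide : Odd 3)).monotone (by linarith)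
      linarith
    have : (a + 1) ^ 3 ≤ b ^ 3 :=
      (Odd.strictMono_pow (by decide : Odd 3)).monotone (by linarith)
    nlinarith
  · have hx2 : (2 : ℤ) ∣ x := by
      apply Int.prime_two.dvd_of_dvd_pow (n := 3)
      exact ⟨2 * k * (k + 1), by rw [← hprod, hk]; ring⟩
    obtain ⟨w, rfl⟩ := hx2
    have hkw : k * (k + 1) = 2 * w ^ 3 := by rw [hk] at hprod; linarith
    rcases Int.even_or_odd' k with ⟨m, hm | hm⟩
    · exfalso
      have hmw : m * (k + 1) = w ^ 3 := by rw [hm] at hkw ⊢; linarith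
      have hco : IsCoprime m (k + 1) := ⟨-2, 1, by rw [hm]; ring⟩
      obtain ⟨⟨b, hb⟩, ⟨a, ha⟩⟩ := cubes hco hmw
      refine descent _ a (-1) b rfl ?_ ?_ ?_ ?_
      · exact isCoprime_one_right.neg_right
      · linear_combination 2 * hb - ha + hm
      · rintro rfl; norm_num at hb; omega
      · rintro rfl; norm_num at ha; omega
    · have hmw : k * (m + 1) = w ^ 3 := by rw [hm] at hkw ⊢; linarith
      have hco : IsCoprime k (m + 1) := ⟨-1, 2, by rw [hm]; ring⟩
      obtain ⟨⟨a, ha⟩, ⟨b, hb⟩⟩ := cubes hco hmw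
      by_cases ha1 : a = 1
      · subst ha1
        have hk1 : k = 1 := by simpa using ha
        have hm0 : m = 0 := by omega
        rw [hk1, hm0] at hmw
        have hw1 : w = 1 := by
          apply (Odd.strictMono_pow (by decide : Odd 3)).injective
          simpa using hmw.symm
        omega
      · exfalso
        refine descent _ a 1 b rfl isCoprime_one_right ?_ ?_ ha1
        · linear_combination 2 * hb - ha + hm
        · rintro rfl; norm_num at hb; omega

theorem part_two (x y : ℤ) (hy : 2 ≤ y) (h : x ^ 3 - y ^ 2 = 1) : False := by
  have hyev : Even y := by
    by_contra ho
    obtain ⟨k, hk⟩ := Int.not_even_iff_odd.1 ho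
    have h2 : (2 : ℤ) ∣ x := by
      apply Int.prime_two.dvd_of_dvd_pow (n := 3)
      exact ⟨2 * k ^ 2 + 2 * k + 1, by rw [hk] at h; linarith⟩
    obtain ⟨w, rfl⟩ := h2
    have h3 : 4 * (2 * w ^ 3 - k ^ 2 - k) = 2 := by rw [hk] at h; linarith
    omega
  obtain ⟨k, hk⟩ := hyev
  have hco : IsCoprime (⟨y, 1⟩ : GaussianInt) ⟨y, -1⟩ := by
    refine ⟨⟨y, -1⟩ + ⟨0, 2 * k ^ 2⟩, ⟨0, -2 * k ^ 2⟩, ?_⟩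
    ext <;> simp <;> rw [hk] <;> ring
  have hmul : (⟨y, 1⟩ : GaussianInt) * ⟨y, -1⟩ = (⟨x, 0⟩ : GaussianInt) ^ 3 := by
    ext <;> simp [pow_succ]
    linarith
  obtain ⟨g, e, hg⟩ := exists_associated_pow_of_mul_eq_pow' hco hmul
  have he : (e : GaussianInt).norm = 1 := (Zsqrtd.norm_eq_one_iff' (by norm_num) _).2 e.isUnit
  generalize (e : GaussianInt) = e' at hg he
  obtain ⟨e0, f0⟩ := e'
  obtain ⟨a, b⟩ := g
  have hre := congrArg Zsqrtd.re hg
  have him := congrArg Zsqrtd.im hg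
  simp [pow_succ] at hre him
  simp [Zsqrtd.norm] at he
  have key : ∀ c d : ℤ, d * (3 * c ^ 2 - d ^ 2) = 1 → c * (c ^ 2 - 3 * d ^ 2) = y → False := by
    intro c d h1 h2
    rcases Int.eq_one_or_neg_one_of_mul_eq_one h1 with rfl | rfl
    · have : 3 * c ^ 2 = 2 := by linarith
      omega
    · have : c ^ 2 = 0 := by linarith
      have : c = 0 := by simpa using this
      subst this
      linarith
  by_cases hf : f0 = 0
  · subst hf
    have : e0 = 1 ∨ e0 = -1 := by
      exact sq_eq_one_iff.1 (by linarith)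
    rcases this with rfl | rfl
    · exact key a b (by linarith) (by linarith)
    · exact key (-a) (-b) (by linarith) (by linarith)
  · have hf1 : 0 < f0 ^ 2 := sq_pos_of_ne_zero hf
    have he0 : e0 = 0 := by
      have : e0 ^ 2 = 0 := by nlinarith [sq_nonneg e0]
      simpa using this
    subst he0
    have : f0 = 1 ∨ f0 = -1 := by
      exact sq_eq_one_iff.1 (by linarith)
    rcases this with rfl | rfl
    · exact key b (-a) (by linarith) (by linarith)
    · exact key (-b) a (by linarith) (by linarith)

theorem euler_cube_square :
    (∀ x y : ℕ, 2 ≤ x → 2 ≤ y → ((x : ℤ)^3 - (y : ℤ)^2 = -1 ↔ x = 2 ∧ y = 3)) ∧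
    (∀ x y : ℕ, 2 ≤ x → 2 ≤ y → (x : ℤ)^3 - (y : ℤ)^2 ≠ 1) := by
  refine ⟨fun x y hx hy => ⟨fun h => ?_, ?_⟩, fun x y hx hy h => ?_⟩
  · have := part_one x y (by exact_mod_cast hy) h
    omega
  · rintro ⟨rfl, rfl⟩
    norm_num
  · exact part_two x y (by exact_mod_cast hy) h
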